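/- Under the fixed effects multivariate linear model, E[(1/n) YᵀY] = BᵀB + Σ_e and E[(1/n²) YᵀXXᵀY] = ((p+n+1)/n) BᵀB + (p/n) Σ_e. Consequently, the method-of-moments estimators Ŵ_b = −(p/(n(n+1))) YᵀY + (1/(n(n+1))) YᵀXXᵀY and Σ̂_e = ((p+n+1)/(n(n+1))) YᵀY − (1/(n(n+1))) YᵀXXᵀY satisfy E[Ŵ_b] = BᵀB and E[Σ̂_e] = Σ_e. -/

import Mathlib

open MeasureTheory ProbabilityTheory Matrix
open scoped BigOperators

/-- A probability law on `Fin q → ℝ` is the centered Gaussian with covariance matrix `S`,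
characterized by the fact that every linear functional has the induced real Gaussian law. -/
def IsCenteredGaussianLaw {q : ℕ} (μ : Measure (Fin q → ℝ))
    (S : Matrix (Fin q) (Fin q) ℝ) : Prop :=
  ∀ u : Fin q → ℝ,
    Measure.map (fun v => ∑ j, u j * v j) μ = gaussianReal 0 (Real.toNNReal (u ⬝ᵥ S *ᵥ u))

/-- `f` is integrable with integral `c`. -/
def HasExpectation {Ω : Type*} [MeasurableSpace Ω] (P : Measure Ω) (f : Ω → ℝ) (c : ℝ) : Prop :=
  Integrable f P ∧ ∫ ω, f ω ∂P = c

namespace HasExpectation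

variable {Ω : Type*} [MeasurableSpace Ω] {P : Measure Ω} {f g : Ω → ℝ} {a b : ℝ}

lemma add (hf : HasExpectation P f a) (hg : HasExpectation P g b) :
    HasExpectation P (fun ω => f ω + g ω) (a + b) :=
  ⟨hf.1.add hg.1, by rw [integral_add hf.1 hg.1, hf.2, hg.2]⟩

lemma sub (hf : HasExpectation P f a) (hg : HasExpectation P g b) :
    HasExpectation P (fun ω => f ω - g ω) (a - b) :=
  ⟨hf.1.sub hg.1, by rw [integral_sub hf.1 hg.1, hf.2, hg.2]⟩

lemma const_mul (c : ℝ) (hf : HasExpectation P f a) :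
    HasExpectation P (fun ω => c * f ω) (c * a) :=
  ⟨hf.1.const_mul c, by rw [integral_const_mul, hf.2]⟩

lemma sum {ι : Type*} {s : Finset ι} {f : ι → Ω → ℝ} {a : ι → ℝ}
    (h : ∀ i, HasExpectation P (f i) (a i)) :
    HasExpectation P (fun ω => ∑ i ∈ s, f i ω) (∑ i ∈ s, a i) :=
  ⟨integrable_finsetSum _ fun i _ => (h i).1, by
    rw [integral_finsetSum _ fun i _ => (h i).1]
    exact Finset.sum_congr rfl fun i _ => (h i).2⟩

lemma mul_of_indepFun (hf : HasExpectation P f a) (hg : HasExpectation P g b)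
    (hfg : IndepFun f g P) : HasExpectation P (fun ω => f ω * g ω) (a * b) :=
  ⟨hfg.integrable_mul hf.1 hg.1, by
    rw [hfg.integral_fun_mul_eq_mul_integral hf.1.aestronglyMeasurable
      hg.1.aestronglyMeasurable, hf.2, hg.2]⟩

lemma comp_of_map_eq {α : Type*} [MeasurableSpace α] {μ : Measure α} {Z : Ω → α}
    (hZ : AEMeasurable Z P) (hmap : P.map Z = μ) {f : α → ℝ} (hf : HasExpectation μ f a) :
    HasExpectation P (fun ω => f (Z ω)) a := by
  subst hmap
  exact ⟨hf.1.comp_aemeasurable hZ, by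
    rw [← integral_map hZ hf.1.aestronglyMeasurable, hf.2]⟩

lemma pi_prod {ι : Type*} [Fintype ι] {α : ι → Type*} [∀ i, MeasurableSpace (α i)]
    {μ : ∀ i, Measure (α i)} [∀ i, SigmaFinite (μ i)] {f : ∀ i, α i → ℝ} {a : ι → ℝ}
    (h : ∀ i, HasExpectation (μ i) (f i) (a i)) :
    HasExpectation (Measure.pi μ) (fun x => ∏ i, f i (x i)) (∏ i, a i) :=
  ⟨Integrable.fintype_prod_dep fun i => (h i).1, by
    rw [integral_fintype_prod_eq_prod]
    exact Finset.prod_congr rfl fun i _ => (h i).2⟩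

lemma comp_eval {ι : Type*} [Fintype ι] {α : ι → Type*} [∀ i, MeasurableSpace (α i)]
    {μ : ∀ i, Measure (α i)} [∀ i, IsProbabilityMeasure (μ i)] (i : ι) {f : α i → ℝ}
    (h : HasExpectation (μ i) f a) :
    HasExpectation (Measure.pi μ) (fun x => f (x i)) a :=
  h.comp_of_map_eq (measurable_pi_apply i).aemeasurable (measurePreserving_eval μ i).map_eq

end HasExpectation

lemma integrable_pow_gaussianReal (m : ℝ) (v : NNReal) (k : ℕ) :
    Integrable (fun x : ℝ => x ^ k) (gaussianReal m v) :=
  integrable_pow_of_mem_interior_integrableExpSet (X := fun x : ℝ => x) (by simp) k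

lemma integral_pow_stdGaussian (k : ℕ) :
    ∫ x, x ^ k ∂gaussianReal 0 1 = iteratedDeriv k (fun t => Real.exp (t ^ 2 / 2)) 0 := by
  have h := iteratedDeriv_mgf_zero (X := fun x : ℝ => x) (μ := gaussianReal 0 1) (by simp) k
  rw [mgf_fun_id_gaussianReal] at h
  simpa using h.symm

lemma deriv_mul_exp_sq_div_two {f f' : ℝ → ℝ} (hf : ∀ t, HasDerivAt f (f' t) t) :
    deriv (fun t => f t * Real.exp (t ^ 2 / 2))
      = fun t => (f' t + t * f t) * Real.exp (t ^ 2 / 2) := by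
  ext t
  have h : HasDerivAt (fun t : ℝ => t ^ 2 / 2) t t := by
    simpa using ((hasDerivAt_id t).pow 2).div_const 2
  rw [((hf t).fun_mul h.exp).deriv]
  ring

lemma integral_pow_stdGaussian_le_four :
    ∫ x, x ^ 1 ∂gaussianReal 0 1 = (0 : ℝ) ∧ ∫ x, x ^ 2 ∂gaussianReal 0 1 = (1 : ℝ) ∧
    ∫ x, x ^ 3 ∂gaussianReal 0 1 = (0 : ℝ) ∧ ∫ x, x ^ 4 ∂gaussianReal 0 1 = (3 : ℝ) := by
  have d1 : deriv (fun t => Real.exp (t ^ 2 / 2)) = fun t => t * Real.exp (t ^ 2 / 2) := by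
    simpa using deriv_mul_exp_sq_div_two (f := fun _ => 1) (fun t => hasDerivAt_const t 1)
  have d2 := deriv_mul_exp_sq_div_two (f := fun t => t) (fun t => hasDerivAt_id t)
  have d3 := deriv_mul_exp_sq_div_two (f := fun t => 1 + t * t)
    (fun t => ((hasDerivAt_id t).mul (hasDerivAt_id t)).const_add 1)
  have d4 := deriv_mul_exp_sq_div_two (f := fun t => 1 * id t + id t * 1 + t * (1 + t * t))
    (fun t => ((((hasDerivAt_id t).const_mul 1).add ((hasDerivAt_id t).mul_const 1))).add
      ((hasDerivAt_id t).mul (((hasDerivAt_id t).mul (hasDerivAt_id t)).const_add 1)))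
  simp only [integral_pow_stdGaussian, iteratedDeriv_succ', iteratedDeriv_zero, d1, d2, d3, d4]
  norm_num

lemma hasExpectation_pi_stdGaussian_prod_pow {ι : Type*} [Fintype ι] (c : ι → ℕ) :
    HasExpectation (Measure.pi fun _ : ι => gaussianReal 0 1) (fun x => ∏ i, x i ^ c i)
      (∏ i, ∫ x, x ^ c i ∂gaussianReal 0 1) :=
  HasExpectation.pi_prod (f := fun i (x : ℝ) => x ^ c i)
    fun i => ⟨integrable_pow_gaussianReal 0 1 (c i), rfl⟩

lemma hasExpectation_pi_stdGaussian_eval {ι : Type*} [Fintype ι] (s : ι) :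
    HasExpectation (Measure.pi fun _ : ι => gaussianReal 0 1) (fun x => x s) 0 := by
  refine HasExpectation.comp_eval (μ := fun _ : ι => gaussianReal 0 1) s (f := fun x => x) ⟨?_, ?_⟩
  · simpa using integrable_pow_gaussianReal 0 1 1
  · simp

section

variable {ι : Type*} [Fintype ι] [DecidableEq ι]

/-- The fourth moments of a standard Gaussian vector (Isserlis' formula). -/
lemma hasExpectation_pi_stdGaussian_mul_four (s t u v : ι) :
    HasExpectation (Measure.pi fun _ : ι => gaussianReal 0 1)
      (fun x => x s * x t * x u * x v)
      ((if s = t ∧ u = v then 1 else 0) + (if s = u ∧ t = v then 1 else 0)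
        + (if s = v ∧ t = u then 1 else 0)) := by
  obtain ⟨m1, m2, m3, m4⟩ := integral_pow_stdGaussian_le_four
  set c : ι → ℕ := fun i => (if s = i then 1 else 0) + (if t = i then 1 else 0)
    + (if u = i then 1 else 0) + (if v = i then 1 else 0) with hc
  have h := hasExpectation_pi_stdGaussian_prod_pow c
  have hprod : (fun x : ι → ℝ => ∏ i, x i ^ c i) = fun x => x s * x t * x u * x v := by
    ext x
    simp [hc, pow_add, Finset.prod_mul_distrib, Finset.prod_pow_boole, -pow_ite]
  rw [hprod] at h
  convert h using 1
  have one (hi : ∀ i, c i = 0 ∨ c i = 2) :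
      ∏ i, ∫ x, x ^ c i ∂gaussianReal 0 1 = (1 : ℝ) := by
    refine Finset.prod_eq_one fun i _ => ?_
    rcases hi i with h | h <;> simp only [h, m2]
    simp
  have odd (i : ι) (hi : c i = 1 ∨ c i = 3) :
      ∏ i, ∫ x, x ^ c i ∂gaussianReal 0 1 = (0 : ℝ) :=
    Finset.prod_eq_zero (Finset.mem_univ i)
      (by rcases hi with h | h <;> simp only [h, m1, m3])
  have all (h1 : s = t) (h2 : s = u) (h3 : s = v) :
      ∏ i, ∫ x, x ^ c i ∂gaussianReal 0 1 = (3 : ℝ) := by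
    subst h1 h2 h3
    rw [Finset.prod_eq_single s]
    · simp [hc, m4]
    · intro i _ hi
      simp [hc, hi.symm]
    · simp
  by_cases hst : s = t
  · subst hst
    by_cases huv : u = v
    · subst huv
      by_cases hsu : s = u
      · rw [all rfl hsu hsu]
        norm_num [hsu]
      · rw [one (by intro i; simp only [hc]; grind)]
        simp [hsu]
    · by_cases hsu : s = u
      · rw [odd v (by simp only [hc]; grind)]
        grind
      · rw [odd u (by simp only [hc]; grind)]
        grind
  · by_cases hsu : s = u
    · subst hsu
      by_cases htv : t = v
      · rw [one (by intro i; simp only [hc]; grind)]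
        grind
      · rw [odd t (by simp only [hc]; grind)]
        grind
    · by_cases hsv : s = v
      · subst hsv
        by_cases htu : t = u
        · rw [one (by intro i; simp only [hc]; grind)]
          grind
        · rw [odd t (by simp only [hc]; grind)]
          grind
      · rw [odd s (by simp only [hc]; grind)]
        grind

lemma integrable_pi_stdGaussian_mul_three (s t u : ι) :
    Integrable (fun x => x s * x t * x u) (Measure.pi fun _ : ι => gaussianReal 0 1) := by
  have h := hasExpectation_pi_stdGaussian_prod_pow fun i =>
    (if s = i then 1 else 0) + (if t = i then 1 else 0) + (if u = i then 1 else 0)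
  simpa [pow_add, Finset.prod_mul_distrib, Finset.prod_pow_boole, -pow_ite] using h.1

lemma hasExpectation_pi_stdGaussian_mul (s t : ι) :
    HasExpectation (Measure.pi fun _ : ι => gaussianReal 0 1) (fun x => x s * x t)
      (if s = t then 1 else 0) := by
  obtain ⟨m1, m2, -, -⟩ := integral_pow_stdGaussian_le_four
  have h := hasExpectation_pi_stdGaussian_prod_pow fun i =>
    (if s = i then 1 else 0) + (if t = i then 1 else 0)
  have hprod : (fun x : ι → ℝ => ∏ i, x i ^ ((if s = i then 1 else 0) + (if t = i then 1 else 0)))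
      = fun x => x s * x t := by
    ext x
    simp [pow_add, Finset.prod_mul_distrib, Finset.prod_pow_boole, -pow_ite]
  rw [hprod] at h
  convert h using 1
  split_ifs with hst
  · subst hst
    refine (Finset.prod_eq_one fun i _ => ?_).symm
    by_cases hi : s = i <;> simp [hi, m2]
  · refine (Finset.prod_eq_zero (Finset.mem_univ s) ?_).symm
    simp [Ne.symm hst]

end

namespace IsCenteredGaussianLaw

variable {q : ℕ} {μ : Measure (Fin q → ℝ)} {S : Matrix (Fin q) (Fin q) ℝ}

lemma hasExpectation_linear (h : IsCenteredGaussianLaw μ S) (u : Fin q → ℝ) :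
    HasExpectation μ (fun v => ∑ j, u j * v j) 0 :=
  HasExpectation.comp_of_map_eq (f := fun x => x) (by fun_prop : Measurable fun v : Fin q → ℝ => ∑ j, u j * v j).aemeasurable (h u)
    ⟨by simpa using integrable_pow_gaussianReal 0 _ 1, by simp⟩

lemma hasExpectation_linear_sq (h : IsCenteredGaussianLaw μ S) (hS : S.PosSemidef)
    (u : Fin q → ℝ) :
    HasExpectation μ (fun v => (∑ j, u j * v j) ^ 2) (u ⬝ᵥ S *ᵥ u) := by
  refine HasExpectation.comp_of_map_eq (f := fun x => x ^ 2) (by fun_prop : Measurable fun v : Fin q → ℝ => ∑ j, u j * v j).aemeasurable (h u)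
    ⟨integrable_pow_gaussianReal 0 _ 2, ?_⟩
  have hvar := variance_fun_id_gaussianReal (μ := 0) (v := Real.toNNReal (u ⬝ᵥ S *ᵥ u))
  rw [variance_of_integral_eq_zero (by fun_prop) (by simp)] at hvar
  rw [hvar, Real.coe_toNNReal]
  simpa using hS.dotProduct_mulVec_nonneg u

lemma hasExpectation_eval (h : IsCenteredGaussianLaw μ S) (k : Fin q) :
    HasExpectation μ (fun v => v k) 0 := by
  simpa [Pi.single_apply] using h.hasExpectation_linear (Pi.single k 1)

lemma hasExpectation_mul (h : IsCenteredGaussianLaw μ S) (hS : S.PosSemidef) (k l : Fin q) :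
    HasExpectation μ (fun v => v k * v l) (S k l) := by
  have hk := h.hasExpectation_linear_sq hS (Pi.single k 1)
  have hl := h.hasExpectation_linear_sq hS (Pi.single l 1)
  have hkl := h.hasExpectation_linear_sq hS (Pi.single k 1 + Pi.single l 1)
  have hsymm : S l k = S k l := by simpa using hS.1.apply k l
  have := ((hkl.sub hk).sub hl).const_mul (1 / 2)
  simp only [Pi.add_apply, add_mul, Finset.sum_add_distrib, Pi.single_apply, ite_mul, one_mul,
    zero_mul, Finset.sum_ite_eq', Finset.mem_univ, if_true, add_dotProduct, mulVec_add,
    dotProduct_add, single_dotProduct, mulVec_single, MulOpposite.op_one, one_smul,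
    col_apply, hsymm] at this
  convert this using 2 <;> ring

/-- Second moments of an array whose rows are independent with a centered Gaussian law. -/
lemma hasExpectation_pi_mul (h : IsCenteredGaussianLaw μ S) (hS : S.PosSemidef)
    [IsProbabilityMeasure μ] {ι : Type*} [Fintype ι] [DecidableEq ι] (i j : ι) (k l : Fin q) :
    HasExpectation (Measure.pi fun _ : ι => μ) (fun e => e i k * e j l)
      (if i = j then S k l else 0) := by
  split_ifs with hij
  · subst hij
    exact HasExpectation.comp_eval (μ := fun _ : ι => μ) i (h.hasExpectation_mul hS k l)
  · have hi := HasExpectation.comp_eval (μ := fun _ : ι => μ) i (h.hasExpectation_eval k)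
    have hj := HasExpectation.comp_eval (μ := fun _ : ι => μ) j (h.hasExpectation_eval l)
    have hind : iIndepFun (fun (i : ι) (e : ι → Fin q → ℝ) => e i) (Measure.pi fun _ : ι => μ) :=
      iIndepFun_pi (X := fun _ e => e) fun _ => aemeasurable_id
    simpa using hi.mul_of_indepFun hj
      ((hind.indepFun hij).comp (measurable_pi_apply k) (measurable_pi_apply l))

end IsCenteredGaussianLaw

section RegressionMoments

variable {Ω : Type*} [MeasurableSpace Ω] {P : Measure Ω} {n p q : ℕ}
  {X : Ω → Matrix (Fin n) (Fin p) ℝ} {E : Ω → Matrix (Fin n) (Fin q) ℝ}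
  {S : Matrix (Fin q) (Fin q) ℝ}

lemma hasExpectation_transpose_mul_self
    (hXX : ∀ s t : Fin n × Fin p,
      HasExpectation P (fun ω => X ω s.1 s.2 * X ω t.1 t.2) (if s = t then 1 else 0))
    (hXE : ∀ (s : Fin n × Fin p) i k, HasExpectation P (fun ω => X ω s.1 s.2 * E ω i k) 0)
    (hEE : ∀ i j k l, HasExpectation P (fun ω => E ω i k * E ω j l) (if i = j then S k l else 0))
    (B : Matrix (Fin p) (Fin q) ℝ) (k l : Fin q) :
    HasExpectation P (fun ω => ((X ω * B + E ω)ᵀ * (X ω * B + E ω)) k l)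
      (n * (Bᵀ * B + S) k l) := by
  have key (i : Fin n) := (((HasExpectation.sum (s := Finset.univ) fun a =>
    HasExpectation.sum (s := Finset.univ) fun b =>
      (hXX (i, a) (i, b)).const_mul (B a k * B b l)).add
    (HasExpectation.sum (s := Finset.univ) fun a => (hXE (i, a) i l).const_mul (B a k))).add
    (HasExpectation.sum (s := Finset.univ) fun b => (hXE (i, b) i k).const_mul (B b l))).add
    (hEE i i k l)
  convert HasExpectation.sum (s := Finset.univ) key using 1
  · ext ω
    simp only [mul_apply, transpose_apply, Matrix.add_apply]
    refine Finset.sum_congr rfl fun i _ => ?_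
    rw [add_mul, mul_add, mul_add, Finset.sum_mul_sum, Finset.sum_mul, Finset.mul_sum,
      ← add_assoc]
    congr 1
    congr 1
    · congr 1
      · exact Finset.sum_congr rfl fun a _ => Finset.sum_congr rfl fun b _ => by ring
      · exact Finset.sum_congr rfl fun a _ => by ring
    · exact Finset.sum_congr rfl fun a _ => by ring
  · simp [mul_apply, mul_add]

lemma sum_mul_fourth_moment (B : Matrix (Fin p) (Fin q) ℝ) (k l : Fin q) :
    ∑ j : Fin n, ∑ a : Fin p, ∑ i : Fin n, ∑ b : Fin p, ∑ c : Fin p, B b k * B c l *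
      ((if (i, b) = (i, a) ∧ (j, a) = (j, c) then 1 else 0)
        + (if (i, b) = (j, a) ∧ (i, a) = (j, c) then 1 else 0)
        + (if (i, b) = (j, c) ∧ (i, a) = (j, a) then 1 else 0))
      = n * (p + n + 1) * (Bᵀ * B) k l := by
  have h (i j : Fin n) (a b c : Fin p) :
      ((if (i, b) = (i, a) ∧ (j, a) = (j, c) then 1 else 0)
        + (if (i, b) = (j, a) ∧ (i, a) = (j, c) then 1 else 0)
        + (if (i, b) = (j, c) ∧ (i, a) = (j, a) then 1 else 0) : ℝ)
      = (if b = a then (if a = c then 1 else 0) else 0)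
        + (if j = i then (if b = a then (if a = c then 1 else 0) else 0) else 0)
        + (if j = i then (if b = c then 1 else 0) else 0) := by
    grind
  have hdiag (a : Fin p) :
      ∑ b, ∑ c, B b k * B c l * (if b = a then (if a = c then 1 else 0) else 0)
        = B a k * B a l := by
    simp [Finset.sum_ite_irrel]
  have hfull : ∑ b, ∑ c, B b k * B c l * (if b = c then 1 else 0) = (Bᵀ * B) k l := by
    simp [mul_apply]
  have hite (i j : Fin n) (f : Fin p → Fin p → ℝ) :
      ∑ b, ∑ c, B b k * B c l * (if j = i then f b c else 0)
        = if j = i then ∑ b, ∑ c, B b k * B c l * f b c else 0 := by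
    split_ifs <;> simp
  simp only [h, mul_add, Finset.sum_add_distrib, hite, hdiag, hfull, Finset.sum_ite_eq,
    Finset.mem_univ, if_true, Finset.sum_const, Finset.card_univ, Fintype.card_fin, nsmul_eq_mul,
    ← Finset.mul_sum]
  simp only [mul_apply, transpose_apply]
  ring

lemma hasExpectation_transpose_mul_gram_mul
    (hXXXX : ∀ s t u v : Fin n × Fin p,
      HasExpectation P (fun ω => X ω s.1 s.2 * X ω t.1 t.2 * X ω u.1 u.2 * X ω v.1 v.2)
        ((if s = t ∧ u = v then 1 else 0) + (if s = u ∧ t = v then 1 else 0)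
          + (if s = v ∧ t = u then 1 else 0)))
    (hXXXE : ∀ (s t u : Fin n × Fin p) i k, HasExpectation P
      (fun ω => X ω s.1 s.2 * X ω t.1 t.2 * X ω u.1 u.2 * E ω i k) 0)
    (hXXEE : ∀ (s t : Fin n × Fin p) i j k l, HasExpectation P
      (fun ω => X ω s.1 s.2 * X ω t.1 t.2 * (E ω i k * E ω j l))
      ((if s = t then 1 else 0) * if i = j then S k l else 0))
    (B : Matrix (Fin p) (Fin q) ℝ) (k l : Fin q) :
    HasExpectation P
      (fun ω => ((X ω * B + E ω)ᵀ * X ω * (X ω)ᵀ * (X ω * B + E ω)) k l)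
      (n * (p + n + 1) * (Bᵀ * B) k l + n * p * S k l) := by
  have key (j : Fin n) (a : Fin p) (i : Fin n) :=
    (((HasExpectation.sum (s := Finset.univ) fun b =>
      HasExpectation.sum (s := Finset.univ) fun c =>
        (hXXXX (i, b) (i, a) (j, a) (j, c)).const_mul (B b k * B c l)).add
    (HasExpectation.sum (s := Finset.univ) fun b =>
      (hXXXE (i, b) (i, a) (j, a) j l).const_mul (B b k))).add
    (HasExpectation.sum (s := Finset.univ) fun c =>
      (hXXXE (i, a) (j, a) (j, c) i k).const_mul (B c l))).add
    (hXXEE (i, a) (j, a) i j k l)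
  convert HasExpectation.sum (s := Finset.univ) fun j =>
    HasExpectation.sum (s := Finset.univ) fun a =>
      HasExpectation.sum (s := Finset.univ) fun i => key j a i using 1
  · ext ω
    rw [mul_apply]
    refine Finset.sum_congr rfl fun j _ => ?_
    rw [mul_apply, Finset.sum_mul]
    refine Finset.sum_congr rfl fun a _ => ?_
    rw [mul_apply, Finset.sum_mul, Finset.sum_mul]
    refine Finset.sum_congr rfl fun i _ => ?_
    simp only [mul_apply, transpose_apply, Matrix.add_apply]
    have expand (u v e f x y : ℝ) : (u + e) * x * y * (v + f)
        = u * v * (x * y) + u * (x * y * f) + v * (x * y * e) + x * y * (e * f) := by ring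
    rw [expand, Finset.sum_mul_sum]
    simp only [Finset.sum_mul]
    congr 1
    congr 1
    · congr 1
      · exact Finset.sum_congr rfl fun b _ => Finset.sum_congr rfl fun c _ => by ring
      · exact Finset.sum_congr rfl fun b _ => by ring
    · exact Finset.sum_congr rfl fun c _ => by ring
  · have hS (i j : Fin n) (a : Fin p) :
        ((if (i, a) = (j, a) then 1 else 0) * if i = j then S k l else 0)
          = if j = i then S k l else 0 := by
      grind
    simp only [mul_zero, Finset.sum_const_zero, add_zero, Finset.sum_add_distrib, hS]
    rw [sum_mul_fourth_moment]
    simp [mul_assoc]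

end RegressionMoments

/-- **Unbiasedness of the method-of-moments estimators in the fixed effects multivariate
linear model** `Y = XB + E`, where `X` has i.i.d. `N(0,1)` entries, `B` is deterministic,
and the rows of `E` are i.i.d. `N(0, Σₑ)`, with `X` independent of `E`:
`E[(1/n) YᵀY] = BᵀB + Σₑ`, `E[(1/n²) YᵀXXᵀY] = ((p+n+1)/n) BᵀB + (p/n) Σₑ`, and hence
`E[Ŵ_b] = BᵀB` and `E[Σ̂ₑ] = Σₑ` for the estimators
`Ŵ_b = −(p/(n(n+1))) YᵀY + (1/(n(n+1))) YᵀXXᵀY` and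
`Σ̂ₑ = ((p+n+1)/(n(n+1))) YᵀY − (1/(n(n+1))) YᵀXXᵀY` (all identities entrywise). -/
theorem fixed_effects_mom_estimators_unbiased
    {Ω : Type*} [MeasurableSpace Ω] (P : Measure Ω) [IsProbabilityMeasure P]
    (n p q : ℕ) (hn : 0 < n) (hp : 0 < p) (hq : 0 < q)
    (X : Ω → Matrix (Fin n) (Fin p) ℝ) (E : Ω → Matrix (Fin n) (Fin q) ℝ)
    (hXmeas : Measurable fun ω => fun ij : Fin n × Fin p => X ω ij.1 ij.2)
    (hEmeas : Measurable fun ω => fun i : Fin n => fun j : Fin q => E ω i j)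
    -- the entries of `X` are i.i.d. standard Gaussian
    (hX : Measure.map (fun ω => fun ij : Fin n × Fin p => X ω ij.1 ij.2) P
        = Measure.pi fun _ : Fin n × Fin p => gaussianReal 0 1)
    -- the rows of `E` are i.i.d. centered Gaussian with covariance `Se`
    (Se : Matrix (Fin q) (Fin q) ℝ) (hSe : Se.PosSemidef)
    (μe : Measure (Fin q → ℝ)) [IsProbabilityMeasure μe] (hμe : IsCenteredGaussianLaw μe Se)
    (hE : Measure.map (fun ω => fun i : Fin n => fun j : Fin q => E ω i j) P
        = Measure.pi fun _ : Fin n => μe)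
    -- `X` and `E` are independent
    (hindep : IndepFun (fun ω => fun ij : Fin n × Fin p => X ω ij.1 ij.2)
        (fun ω => fun i : Fin n => fun j : Fin q => E ω i j) P)
    (B : Matrix (Fin p) (Fin q) ℝ)
    (Y : Ω → Matrix (Fin n) (Fin q) ℝ) (hY : ∀ ω, Y ω = X ω * B + E ω) :
    (∀ k l, ∫ ω, (((1 : ℝ) / n) • ((Y ω)ᵀ * Y ω)) k l ∂P = (Bᵀ * B + Se) k l) ∧
    (∀ k l, ∫ ω, (((1 : ℝ) / n ^ 2) • ((Y ω)ᵀ * X ω * (X ω)ᵀ * Y ω)) k l ∂P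
        = ((((p : ℝ) + n + 1) / n) • (Bᵀ * B) + ((p : ℝ) / n) • Se) k l) ∧
    (∀ k l, ∫ ω, ((-(p : ℝ) / (n * (n + 1))) • ((Y ω)ᵀ * Y ω)
          + ((1 : ℝ) / (n * (n + 1))) • ((Y ω)ᵀ * X ω * (X ω)ᵀ * Y ω)) k l ∂P
        = (Bᵀ * B) k l) ∧
    (∀ k l, ∫ ω, ((((p : ℝ) + n + 1) / (n * (n + 1))) • ((Y ω)ᵀ * Y ω)
          - ((1 : ℝ) / (n * (n + 1))) • ((Y ω)ᵀ * X ω * (X ω)ᵀ * Y ω)) k l ∂P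
        = Se k l) := by
  have hE' := fun i k => HasExpectation.comp_of_map_eq hEmeas.aemeasurable hE
    (HasExpectation.comp_eval (μ := fun _ : Fin n => μe) i (hμe.hasExpectation_eval k))
  have hEE := fun i j k l => HasExpectation.comp_of_map_eq hEmeas.aemeasurable hE
    (hμe.hasExpectation_pi_mul hSe i j k l)
  have hXX := fun s t => HasExpectation.comp_of_map_eq hXmeas.aemeasurable hX
    (hasExpectation_pi_stdGaussian_mul s t)
  have hXE (s : Fin n × Fin p) (i : Fin n) (k : Fin q) :
      HasExpectation P (fun ω => X ω s.1 s.2 * E ω i k) 0 := by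
    simpa using (HasExpectation.comp_of_map_eq hXmeas.aemeasurable hX
      (hasExpectation_pi_stdGaussian_eval s)).mul_of_indepFun (hE' i k)
      (hindep.comp (φ := fun x : Fin n × Fin p → ℝ => x s) (ψ := fun e : Fin n → Fin q → ℝ => e i k) (by fun_prop) (by fun_prop))
  have hXXXE (s t u : Fin n × Fin p) (i : Fin n) (k : Fin q) : HasExpectation P
      (fun ω => X ω s.1 s.2 * X ω t.1 t.2 * X ω u.1 u.2 * E ω i k) 0 := by
    simpa using (HasExpectation.comp_of_map_eq hXmeas.aemeasurable hX
      ⟨integrable_pi_stdGaussian_mul_three s t u, rfl⟩).mul_of_indepFun (hE' i k)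
      (hindep.comp (φ := fun x : Fin n × Fin p → ℝ => x s * x t * x u) (ψ := fun e : Fin n → Fin q → ℝ => e i k)
        (by fun_prop) (by fun_prop))
  have hXXEE (s t : Fin n × Fin p) (i j : Fin n) (k l : Fin q) :=
    (hXX s t).mul_of_indepFun (hEE i j k l)
      (hindep.comp (φ := fun x : Fin n × Fin p → ℝ => x s * x t) (ψ := fun e : Fin n → Fin q → ℝ => e i k * e j l)
        (by fun_prop) (by fun_prop))
  have h1 (k l : Fin q) : HasExpectation P (fun ω => ((Y ω)ᵀ * Y ω) k l)
      (n * (Bᵀ * B + Se) k l) := by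
    simpa only [hY] using hasExpectation_transpose_mul_self hXX hXE hEE B k l
  have h2 (k l : Fin q) : HasExpectation P (fun ω => ((Y ω)ᵀ * X ω * (X ω)ᵀ * Y ω) k l)
      (n * (p + n + 1) * (Bᵀ * B) k l + n * p * Se k l) := by
    simpa only [hY] using hasExpectation_transpose_mul_gram_mul
      (fun s t u v => HasExpectation.comp_of_map_eq hXmeas.aemeasurable hX
        (hasExpectation_pi_stdGaussian_mul_four s t u v)) hXXXE hXXEE B k l
  have hn0 : (n : ℝ) ≠ 0 := by positivity
  have hn1 : (n : ℝ) + 1 ≠ 0 := by positivity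
  refine ⟨fun k l => ?_, fun k l => ?_, fun k l => ?_, fun k l => ?_⟩
  · refine ((h1 k l).const_mul (1 / n)).2.trans ?_
    field_simp
  · refine ((h2 k l).const_mul (1 / n ^ 2)).2.trans ?_
    simp only [Matrix.add_apply, Matrix.smul_apply, smul_eq_mul]
    field_simp
  · refine (((h1 k l).const_mul (-(p : ℝ) / (n * (n + 1)))).add
      ((h2 k l).const_mul (1 / (n * (n + 1))))).2.trans ?_
    simp only [Matrix.add_apply]
    field_simp
    ring
  · refine (((h1 k l).const_mul (((p : ℝ) + n + 1) / (n * (n + 1)))).sub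
      ((h2 k l).const_mul (1 / (n * (n + 1))))).2.trans ?_
    simp only [Matrix.add_apply]
    field_simp
    ring
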